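/- Equivalence of the static Schrödinger bridge problem with entropically regularized optimal transport. Let γ > 0, let p_γ(x,y) = (2πγ)^{-n/2} exp(−|x−y|²/(2γ)), let ρ₀, ρ₁ be probability densities on ℝⁿ with ∫ ρ₀ |log ρ₀| < ∞, and set π^W(x,y) := ρ₀(x) p_γ(x,y). Then for any two probability densities π, π′ on ℝⁿ × ℝⁿ, each a coupling of ρ₀ and ρ₁ with ∫∫ π |log π| < ∞, ∫∫ π′ |log π′| < ∞, ∫∫ |x−y|² dπ < ∞ and ∫∫ |x−y|² dπ′ < ∞, one has D(π‖π^W) ≤ D(π′‖π^W) if and only if ∫∫ (|x−y|²/2) π dx dy + γ ∫∫ π log π dx dy ≤ ∫∫ (|x−y|²/2) π′ dx dy + γ ∫∫ π′ log π′ dx dy. In particular, π minimizes D(·‖π^W) over such couplings if and only if it minimizes the functional ∫∫ (|x−y|²/2) π + γ ∫∫ π log π. -/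

import Mathlib

open MeasureTheory

open Classical in
/-- Kullback–Leibler divergence `D(p‖q) = ∫ p log(p/q)` between two densities on a measure
space, defined to be `+∞` (an `EReal`) if `p` is not absolutely continuous with respect to `q`
or if the integrand fails to be integrable. -/
noncomputable def KLdiv {α : Type*} [MeasureSpace α] (p q : α → ℝ) : EReal :=
  if (∀ᵐ x, q x = 0 → p x = 0) ∧ Integrable (fun x => p x * Real.log (p x / q x)) then
    ((∫ x, p x * Real.log (p x / q x) : ℝ) : EReal)
  else ⊤

/-- A probability density `π` on `ℝⁿ × ℝⁿ` which is a coupling of `ρ₀` and `ρ₁` and has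
finite entropy `∫∫ π |log π| < ∞` and finite quadratic cost `∫∫ |x−y|² dπ < ∞`. -/
def IsFiniteEntropyCoupling {n : ℕ} (ρ₀ ρ₁ : EuclideanSpace ℝ (Fin n) → ℝ)
    (π : EuclideanSpace ℝ (Fin n) × EuclideanSpace ℝ (Fin n) → ℝ) : Prop :=
  Measurable π ∧ (∀ z, 0 ≤ π z) ∧ Integrable π ∧ (∫ z, π z = 1) ∧
    (∀ᵐ x, (∫ y, π (x, y)) = ρ₀ x) ∧ (∀ᵐ y, (∫ x, π (x, y)) = ρ₁ y) ∧
    Integrable (fun z => π z * |Real.log (π z)|) ∧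
    Integrable (fun z : EuclideanSpace ℝ (Fin n) × EuclideanSpace ℝ (Fin n) =>
      ‖z.1 - z.2‖ ^ 2 * π z)

/-- The entropically regularized optimal transport functional
`π ↦ ∫∫ (|x−y|²/2) π + γ ∫∫ π log π`. -/
noncomputable def entropicOTCost {n : ℕ} (γ : ℝ)
    (π : EuclideanSpace ℝ (Fin n) × EuclideanSpace ℝ (Fin n) → ℝ) : ℝ :=
  (∫ z : EuclideanSpace ℝ (Fin n) × EuclideanSpace ℝ (Fin n), ‖z.1 - z.2‖ ^ 2 / 2 * π z)
    + γ * ∫ z, π z * Real.log (π z)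

/-- If `ρ` is the first marginal of the nonnegative density `p`, then integrating a function of the
first coordinate against `p` amounts to integrating it against `ρ`. -/
theorem integrable_and_integral_fst_mul_of_marginal {α β : Type*} [MeasurableSpace α]
    [MeasurableSpace β] {μ : Measure α} {ν : Measure β} [SFinite μ] [SFinite ν]
    {p : α × β → ℝ} {ρ f : α → ℝ} (hp_meas : Measurable p) (hp_nonneg : ∀ z, 0 ≤ p z)
    (hp : Integrable p (μ.prod ν)) (hmarg : ∀ᵐ x ∂μ, (∫ y, p (x, y) ∂ν) = ρ x)
    (hf : Measurable f) (hfρ : Integrable (fun x => f x * ρ x) μ) :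
    Integrable (fun z => f z.1 * p z) (μ.prod ν) ∧
      ∫ z, f z.1 * p z ∂(μ.prod ν) = ∫ x, f x * ρ x ∂μ := by
  have hint : Integrable (fun z => f z.1 * p z) (μ.prod ν) := by
    have hfp_meas : Measurable fun z : α × β => f z.1 * p z :=
      (hf.comp measurable_fst).mul hp_meas
    refine (integrable_prod_iff hfp_meas.aestronglyMeasurable).mpr ⟨hp.prod_right_ae.mono fun x hx => hx.const_mul (f x), hfρ.norm.congr ?_⟩
    filter_upwards [hmarg] with x hx
    have hρ : 0 ≤ ρ x := hx ▸ integral_nonneg fun y => hp_nonneg (x, y)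
    simp only [norm_mul, Real.norm_of_nonneg (hp_nonneg _), Real.norm_of_nonneg hρ]
    rw [integral_const_mul, hx]
  refine ⟨hint, ?_⟩
  rw [integral_prod _ hint]
  refine integral_congr_ae (hmarg.mono fun x hx => ?_)
  simp only [integral_const_mul, hx]

/-- A nonnegative density vanishes almost everywhere above the zeros of its first marginal. -/
theorem ae_eq_zero_of_marginal_eq_zero {α β : Type*} [MeasurableSpace α]
    [MeasurableSpace β] {μ : Measure α} {ν : Measure β} [SFinite μ] [SFinite ν]
    {p : α × β → ℝ} {ρ : α → ℝ} (hp_meas : Measurable p) (hp_nonneg : ∀ z, 0 ≤ p z)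
    (hp : Integrable p (μ.prod ν)) (hmarg : ∀ᵐ x ∂μ, (∫ y, p (x, y) ∂ν) = ρ x)
    (hρ : Measurable ρ) : ∀ᵐ z ∂(μ.prod ν), ρ z.1 = 0 → p z = 0 := by
  let f : α → ℝ := (ρ ⁻¹' {0}).indicator 1
  have hf : Measurable f := measurable_one.indicator (hρ (measurableSet_singleton 0))
  have hf_nonneg : ∀ x, 0 ≤ f x := Set.indicator_nonneg fun _ _ => zero_le_one
  have hfρ : (fun x => f x * ρ x) = fun _ => 0 := by
    funext x
    by_cases hx : ρ x = 0 <;> simp [f, hx]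
  obtain ⟨hint, hzero⟩ := integrable_and_integral_fst_mul_of_marginal hp_meas hp_nonneg hp hmarg hf
    (hfρ ▸ integrable_zero _ _ _)
  rw [hfρ, integral_zero, integral_eq_zero_iff_of_nonneg
    (fun z => mul_nonneg (hf_nonneg z.1) (hp_nonneg z)) hint] at hzero
  filter_upwards [hzero] with z hz hρz
  simpa [f, hρz] using hz

/-- Against the prior `ρ₀(x) c exp(−|x−y|²/(2γ))`, the divergence of a finite-entropy coupling is an
affine function of its regularized transport cost. -/
theorem KLdiv_eq_entropicOTCost {n : ℕ} {γ c : ℝ} (hγ : 0 < γ) (hc : 0 < c)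
    {ρ₀ ρ₁ : EuclideanSpace ℝ (Fin n) → ℝ} (hρ₀_meas : Measurable ρ₀)
    (hρ₀_log : Integrable (fun x => ρ₀ x * |Real.log (ρ₀ x)|))
    {π : EuclideanSpace ℝ (Fin n) × EuclideanSpace ℝ (Fin n) → ℝ}
    (hπ : IsFiniteEntropyCoupling ρ₀ ρ₁ π) :
    KLdiv π (fun z => ρ₀ z.1 * (c * Real.exp (-‖z.1 - z.2‖ ^ 2 / (2 * γ)))) =
      ((γ⁻¹ * entropicOTCost γ π - (∫ x, Real.log (ρ₀ x) * ρ₀ x) - Real.log c : ℝ) : EReal) := by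
  obtain ⟨hmeas, hnonneg, hint, hmass, hfst, -, hent, hquad⟩ := hπ
  have hac : ∀ᵐ z, ρ₀ z.1 = 0 → π z = 0 :=
    ae_eq_zero_of_marginal_eq_zero hmeas hnonneg hint hfst hρ₀_meas
  have hent' : Integrable fun z => π z * Real.log (π z) := by
    refine hent.mono (hmeas.mul (Real.measurable_log.comp hmeas)).aestronglyMeasurable ?_
    exact .of_forall fun z => by simp
  have hlog : Integrable fun x => Real.log (ρ₀ x) * ρ₀ x := by
    refine hρ₀_log.mono ((Real.measurable_log.comp hρ₀_meas).mul hρ₀_meas).aestronglyMeasurable ?_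
    exact .of_forall fun x => by simp [mul_comm]
  obtain ⟨hlogπ, hlogπ_eq⟩ := integrable_and_integral_fst_mul_of_marginal
    (f := fun x => Real.log (ρ₀ x)) hmeas hnonneg hint hfst
    (Real.measurable_log.comp hρ₀_meas) hlog
  have hquad' : Integrable fun z : EuclideanSpace ℝ (Fin n) × EuclideanSpace ℝ (Fin n) =>
      ‖z.1 - z.2‖ ^ 2 / 2 * π z :=
    (hquad.div_const 2).congr (.of_forall fun z => by ring)
  have hexpand : (fun z => γ⁻¹ * (‖z.1 - z.2‖ ^ 2 / 2 * π z) + π z * Real.log (π z)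
        - Real.log (ρ₀ z.1) * π z - Real.log c * π z) =ᵐ[volume]
      fun z => π z * Real.log (π z / (ρ₀ z.1 * (c * Real.exp (-‖z.1 - z.2‖ ^ 2 / (2 * γ))))) := by
    filter_upwards [hac] with z hz
    by_cases hπz : π z = 0
    · simp [hπz]
    have hρz : ρ₀ z.1 ≠ 0 := fun h => hπz (hz h)
    have hexp := Real.exp_ne_zero (-‖z.1 - z.2‖ ^ 2 / (2 * γ))
    rw [Real.log_div hπz (by positivity), Real.log_mul hρz (by positivity),
      Real.log_mul hc.ne' hexp, Real.log_exp]
    field_simp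
    ring
  have hI₁ : Integrable fun z => γ⁻¹ * (‖z.1 - z.2‖ ^ 2 / 2 * π z) + π z * Real.log (π z) :=
    (hquad'.const_mul γ⁻¹).add hent'
  have hI₂ : Integrable fun z => γ⁻¹ * (‖z.1 - z.2‖ ^ 2 / 2 * π z) + π z * Real.log (π z)
      - Real.log (ρ₀ z.1) * π z := hI₁.sub hlogπ
  have hI₃ := hI₂.sub (hint.const_mul (Real.log c))
  have hac' : ∀ᵐ z : EuclideanSpace ℝ (Fin n) × EuclideanSpace ℝ (Fin n),
      ρ₀ z.1 * (c * Real.exp (-‖z.1 - z.2‖ ^ 2 / (2 * γ))) = 0 → π z = 0 :=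
    hac.mono fun z hz hq => hz ((mul_eq_zero.mp hq).resolve_right (by positivity))
  rw [KLdiv, if_pos ⟨hac', hI₃.congr hexpand⟩, ← integral_congr_ae hexpand,
    integral_sub hI₂ (hint.const_mul _), integral_sub hI₁ hlogπ,
    integral_add (hquad'.const_mul _) hent', integral_const_mul, integral_const_mul, hmass,
    entropicOTCost, mul_add, inv_mul_cancel_left₀ hγ.ne', mul_one, ← hlogπ_eq]
  rfl

/-- **Equivalence of the static Schrödinger bridge problem with entropically regularized
optimal transport.** With prior `π^W(x,y) = ρ₀(x) (2πγ)^{-n/2} exp(−|x−y|²/(2γ))`, for any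
two finite-entropy, finite-cost couplings `π, π'` of `ρ₀` and `ρ₁` one has
`D(π‖π^W) ≤ D(π'‖π^W)` iff
`∫∫ (|x−y|²/2) π + γ ∫∫ π log π ≤ ∫∫ (|x−y|²/2) π' + γ ∫∫ π' log π'`;
in particular `π` minimizes `D(·‖π^W)` over such couplings iff it minimizes the
regularized transport functional. -/
theorem schroedinger_bridge_equiv_entropic_OT {n : ℕ} (γ : ℝ) (hγ : 0 < γ)
    (ρ₀ ρ₁ : EuclideanSpace ℝ (Fin n) → ℝ)
    (hρ₀_meas : Measurable ρ₀) (hρ₁_meas : Measurable ρ₁)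
    (hρ₀_nonneg : ∀ x, 0 ≤ ρ₀ x) (hρ₁_nonneg : ∀ y, 0 ≤ ρ₁ y)
    (hρ₀_int : Integrable ρ₀) (hρ₁_int : Integrable ρ₁)
    (hρ₀_mass : ∫ x, ρ₀ x = 1) (hρ₁_mass : ∫ y, ρ₁ y = 1)
    (hρ₀_log : Integrable (fun x => ρ₀ x * |Real.log (ρ₀ x)|)) :
    (∀ π π' : EuclideanSpace ℝ (Fin n) × EuclideanSpace ℝ (Fin n) → ℝ,
      IsFiniteEntropyCoupling ρ₀ ρ₁ π → IsFiniteEntropyCoupling ρ₀ ρ₁ π' →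
      (KLdiv π (fun z => ρ₀ z.1 *
          ((2 * Real.pi * γ) ^ (-(n : ℝ) / 2) * Real.exp (-‖z.1 - z.2‖ ^ 2 / (2 * γ))))
        ≤ KLdiv π' (fun z => ρ₀ z.1 *
          ((2 * Real.pi * γ) ^ (-(n : ℝ) / 2) * Real.exp (-‖z.1 - z.2‖ ^ 2 / (2 * γ))))
        ↔ entropicOTCost γ π ≤ entropicOTCost γ π')) ∧
    (∀ π : EuclideanSpace ℝ (Fin n) × EuclideanSpace ℝ (Fin n) → ℝ,
      IsFiniteEntropyCoupling ρ₀ ρ₁ π →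
      ((∀ π', IsFiniteEntropyCoupling ρ₀ ρ₁ π' →
          KLdiv π (fun z => ρ₀ z.1 *
            ((2 * Real.pi * γ) ^ (-(n : ℝ) / 2) * Real.exp (-‖z.1 - z.2‖ ^ 2 / (2 * γ))))
          ≤ KLdiv π' (fun z => ρ₀ z.1 *
            ((2 * Real.pi * γ) ^ (-(n : ℝ) / 2) * Real.exp (-‖z.1 - z.2‖ ^ 2 / (2 * γ)))))
        ↔ (∀ π', IsFiniteEntropyCoupling ρ₀ ρ₁ π' →
            entropicOTCost γ π ≤ entropicOTCost γ π'))) := by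
  have hc : 0 < (2 * Real.pi * γ) ^ (-(n : ℝ) / 2) := by positivity
  have key : ∀ π π' : EuclideanSpace ℝ (Fin n) × EuclideanSpace ℝ (Fin n) → ℝ,
      IsFiniteEntropyCoupling ρ₀ ρ₁ π → IsFiniteEntropyCoupling ρ₀ ρ₁ π' →
      (KLdiv π (fun z => ρ₀ z.1 *
          ((2 * Real.pi * γ) ^ (-(n : ℝ) / 2) * Real.exp (-‖z.1 - z.2‖ ^ 2 / (2 * γ))))
        ≤ KLdiv π' (fun z => ρ₀ z.1 *
          ((2 * Real.pi * γ) ^ (-(n : ℝ) / 2) * Real.exp (-‖z.1 - z.2‖ ^ 2 / (2 * γ))))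
        ↔ entropicOTCost γ π ≤ entropicOTCost γ π') := by
    intro π π' hπ hπ'
    rw [KLdiv_eq_entropicOTCost hγ hc hρ₀_meas hρ₀_log hπ,
      KLdiv_eq_entropicOTCost hγ hc hρ₀_meas hρ₀_log hπ', EReal.coe_le_coe_iff,
      sub_le_sub_iff_right, sub_le_sub_iff_right, mul_le_mul_iff_right₀ (inv_pos.mpr hγ)]
  exact ⟨key, fun π hπ => forall₂_congr fun π' hπ' => key π π' hπ hπ'⟩
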